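/- arXiv:1808.09544 — 3 statements merged into one kernel-verified Lean document; each statement's English description precedes it below -/
import Mathlib

section
/- (Sah's Lemma.) Let H be a group, k a field, and M a k-vector space equipped with a k-linear action of H. Suppose there exists a central element z ∈ Z(H) that acts on M as multiplication by a scalar λ ∈ k with λ ≠ 1. Then the group cohomology Hⁱ(H, M) vanishes for every i ≥ 0. -/
open CategoryTheory

/-- If the endomorphism of the complex `P` induced by a natural endomorphism `α` of the identity
functor is homotopic to the identity, and `α` acts on `Y` as a scalar `r` with `r - 1` a unit,
then `Hom(P, Y)` is exact. -/
theorem ChainComplex.linearYonedaObj_exactAt_of_homotopy {R C : Type*} [Ring R] [Category C]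
    [Abelian C] [Linear R C] (α : 𝟭 C ⟶ 𝟭 C) (P : ChainComplex C ℕ) (φ : P ⟶ P)
    (hφ : ∀ i, φ.f i = α.app (P.X i)) (h : Homotopy φ (𝟙 P)) (Y : C) (r : R)
    (hr : IsUnit (r - 1)) (hY : α.app Y = r • 𝟙 Y) (n : ℕ) :
    (P.linearYonedaObj R Y).ExactAt n := by
  rw [HomologicalComplex.exactAt_iff' _ (n - 1) n (n + 1) (by cases n <;> simp) (by simp),
    ShortComplex.moduleCat_exact_iff]
  intro (f : P.X n ⟶ Y) (hf : P.d (n + 1) n ≫ f = 0)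
  obtain ⟨u, hu⟩ := hr
  have key : (r - 1) • f = P.d n (n - 1) ≫ h.hom (n - 1) n ≫ f := by
    have h₁ : φ.f n ≫ f = r • f := by
      rw [hφ]
      simpa [hY] using (α.naturality f).symm
    have h₂ := h.comm n =≫ f
    rw [h₁, dNext_nat, Homotopy.prevD_chainComplex] at h₂
    simp only [Preadditive.add_comp, Category.assoc, hf, Limits.comp_zero, add_zero,
      HomologicalComplex.id_f, Category.id_comp] at h₂
    rw [sub_smul, one_smul, h₂, add_sub_cancel_right]
  refine ⟨(↑u⁻¹ : R) • (h.hom (n - 1) n ≫ f), ?_⟩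
  change P.d n (n - 1) ≫ ((↑u⁻¹ : R) • (h.hom (n - 1) n ≫ f)) = f
  rw [Linear.comp_smul, ← key, ← hu, smul_smul, Units.inv_mul, one_smul]

/-- If a natural endomorphism of the identity functor acts trivially on `X` and as a scalar `r`
with `r - 1` a unit on `Y`, then `Hom(P, Y)` is exact for each projective resolution `P` of `X`. -/
theorem CategoryTheory.ProjectiveResolution.linearYonedaObj_exactAt {R C : Type*} [Ring R]
    [Category C] [Abelian C] [Linear R C] (α : 𝟭 C ⟶ 𝟭 C) {X : C} (P : ProjectiveResolution X)
    (hX : α.app X = 𝟙 X) (Y : C) (r : R) (hr : IsUnit (r - 1)) (hY : α.app Y = r • 𝟙 Y) (n : ℕ) :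
    (P.complex.linearYonedaObj R Y).ExactAt n := by
  let φ : P.complex ⟶ P.complex :=
    { f i := α.app (P.complex.X i)
      comm' i j _ := (α.naturality (P.complex.d i j)).symm }
  refine ChainComplex.linearYonedaObj_exactAt_of_homotopy α P.complex φ (fun _ ↦ rfl)
    (liftHomotopy (𝟙 X) φ (𝟙 _) ?_ (by simp)) Y r hr hY n
  rw [CategoryTheory.Functor.map_id, Category.comp_id]
  refine HomologicalComplex.to_single_hom_ext ?_
  have h := (α.naturality (P.π.f 0)).symm
  have hX' : α.app (((ChainComplex.single₀ C).obj X).X 0) = 𝟙 _ := hX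
  rw [hX', Category.comp_id] at h
  exact h

/-- A central element of `G` acts by a natural endomorphism of the identity functor
of `Rep k G`. -/
def Rep.centerAction (k : Type*) {G : Type*} [CommRing k] [Group G] (z : G)
    (hz : z ∈ Subgroup.center G) : 𝟭 (Rep k G) ⟶ 𝟭 (Rep k G) where
  app A := Rep.ofHom ⟨A.ρ z, fun g ↦ by
    change A.ρ z * A.ρ g = A.ρ g * A.ρ z
    rw [← map_mul, ← map_mul, Subgroup.mem_center_iff.1 hz g]⟩
  naturality A B f := by
    ext x
    exact (Rep.hom_comm_apply f z x).symm

/-- **Sah's Lemma.** Let `H` be a group, `k` a field and `M` a `k`-linear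
representation of `H`.  If some central element `z ∈ Z(H)` acts on `M` as multiplication by a
scalar `λ ∈ k` with `λ ≠ 1`, then `Hⁱ(H, M) = 0` for all `i ≥ 0`. -/
theorem stmt2 {k H : Type} [Field k] [Group H] (M : Rep k H)
    (z : H) (hz : z ∈ Subgroup.center H) (lam : k) (hlam : lam ≠ 1)
    (hact : ∀ m : M.V, M.ρ z m = lam • m) :
    ∀ i : ℕ, Subsingleton (groupCohomology M i) := by
  intro i
  refine ModuleCat.subsingleton_of_isZero
    (Limits.IsZero.of_iso ?_ (groupCohomologyIso M i (Rep.barResolution k H)))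
  refine (ProjectiveResolution.linearYonedaObj_exactAt (Rep.centerAction k z hz) _ ?_ M lam
    (sub_ne_zero.2 hlam).isUnit ?_ i).isZero_homology
  · ext
    rfl
  · ext x
    exact hact x
end

section
/- Let p be an odd prime, k a finite field of characteristic p, V a 2-dimensional k-vector space, and H a subgroup of GL(V) such that V is an irreducible k[H]-module and H contains no scalar automorphism λ·id_V with λ ≠ 1. Then: (1) p does not divide the order of H; (2) the subgroup A := H ∩ SL(V) is cyclic of order n for some odd integer n > 2 which divides #k − 1 or #k + 1; (3) the index [H : A] is at most 2, and if [H : A] = 2 then every s ∈ H ∖ A satisfies s² = 1 and s a s⁻¹ = a⁻¹ for all a ∈ A (so H is dihedral of order 2n), and det(H) = {1, −1} ⊆ k^×. -/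
/-- For `H ≤ GL(V)`, the subgroup `H ∩ SL(V)` (of determinant-one elements), as a subgroup
of `H`. -/
noncomputable def slPart {k V : Type} [Field k] [AddCommGroup V] [Module k V]
    (H : Subgroup (V ≃ₗ[k] V)) : Subgroup H :=
  (LinearEquiv.det.comp H.subtype).ker

theorem Matrix.sq_fin_two {R : Type*} [CommRing R] (X : Matrix (Fin 2) (Fin 2) R) :
    X * X = X.trace • X - X.det • 1 := by
  ext i j
  fin_cases i <;> fin_cases j <;>
    simp [Matrix.mul_apply, Fin.sum_univ_two, Matrix.trace, Matrix.det_fin_two] <;> ring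

theorem Matrix.exists_eq_add_smul_of_commute {k : Type*} [Field k]
    {X Y : Matrix (Fin 2) (Fin 2) k} (hX : ∀ c : k, X ≠ c • 1) (h : Commute X Y) :
    ∃ α β : k, Y = α • 1 + β • X := by
  have e (i j) := congrFun₂ h.eq i j
  simp only [Matrix.mul_apply, Fin.sum_univ_two] at e
  have h00 := e 0 0
  have h01 := e 0 1
  have h10 := e 1 0
  by_cases hb : X 0 1 = 0
  · by_cases hc : X 1 0 = 0
    · have hd : X 0 0 - X 1 1 ≠ 0 := by
        intro hd
        refine hX (X 0 0) ?_
        ext i j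
        fin_cases i <;> fin_cases j <;> simp [hb, hc]
        exact (sub_eq_zero.1 hd).symm
      have hY01 : Y 0 1 = 0 := by
        apply mul_left_cancel₀ hd
        linear_combination h01 + (Y 0 0 - Y 1 1) * hb
      have hY10 : Y 1 0 = 0 := by
        apply mul_left_cancel₀ hd
        linear_combination -h10 + (Y 0 0 - Y 1 1) * hc
      refine ⟨Y 0 0 - (Y 0 0 - Y 1 1) / (X 0 0 - X 1 1) * X 0 0,
        (Y 0 0 - Y 1 1) / (X 0 0 - X 1 1), ?_⟩
      ext i j
      fin_cases i <;> fin_cases j <;> simp [hb, hc, hY01, hY10]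
      field_simp
      ring
    · refine ⟨Y 0 0 - Y 1 0 / X 1 0 * X 0 0, Y 1 0 / X 1 0, ?_⟩
      ext i j
      fin_cases i <;> fin_cases j <;> simp [hc]
      · field_simp
        linear_combination -h00
      · field_simp
        linear_combination -h10
  · refine ⟨Y 0 0 - Y 0 1 / X 0 1 * X 0 0, Y 0 1 / X 0 1, ?_⟩
    ext i j
    fin_cases i <;> fin_cases j <;> simp [hb]
    · field_simp
      linear_combination h00
    · field_simp
      linear_combination h01

theorem Matrix.commute_of_commute_of_ne_smul_one {k : Type*} [Field k]
    {X Y Z : Matrix (Fin 2) (Fin 2) k} (hX : ∀ c : k, X ≠ c • 1) (hY : Commute X Y)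
    (hZ : Commute X Z) : Commute Y Z := by
  obtain ⟨α, β, rfl⟩ := exists_eq_add_smul_of_commute hX hY
  exact ((Commute.one_left Z).smul_left α).add_left (hZ.smul_left β)

theorem Matrix.eq_or_mul_eq_one_of_commute {k : Type*} [Field k] (h2 : (2 : k) ≠ 0)
    {X Y : Matrix (Fin 2) (Fin 2) k} (hXd : X.det = 1) (hYd : Y.det = 1)
    (ht : X.trace = Y.trace) (h4 : X.trace ^ 2 ≠ 4) (h : Commute X Y) :
    Y = X ∨ Y * X = 1 := by
  have hX (c : k) : X ≠ c • 1 := by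
    rintro rfl
    apply h4
    rw [Matrix.det_fin_two] at hXd
    rw [Matrix.trace_fin_two]
    simp only [Matrix.smul_apply, Matrix.one_apply, smul_eq_mul] at hXd ⊢
    simp at hXd ⊢
    linear_combination 4 * hXd
  obtain ⟨α, β, rfl⟩ := exists_eq_add_smul_of_commute hX h
  have hα : 2 * α = X.trace * (1 - β) := by
    simp only [Matrix.trace_fin_two, Matrix.add_apply, Matrix.smul_apply, Matrix.one_apply,
      smul_eq_mul] at ht ⊢
    simp at ht
    linear_combination -ht
  have hd : α ^ 2 + α * β * X.trace + β ^ 2 = 1 := by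
    simp [Matrix.trace_fin_two, Matrix.det_fin_two] at hYd hXd ⊢
    linear_combination hYd - β ^ 2 * hXd
  have hβ : (1 - β) * (1 + β) = 0 := by
    apply mul_left_cancel₀ (sub_ne_zero.2 h4)
    linear_combination 4 * hd - (2 * α + X.trace * (1 + β)) * hα
  have hα' (c : k) (hc : 2 * α = 2 * c) : α = c := mul_left_cancel₀ h2 hc
  rcases mul_eq_zero.1 hβ with hβ | hβ
  · left
    have hb : β = 1 := by linear_combination -hβ
    have ha : α = 0 := hα' 0 (by rw [hα, hb]; ring)
    simp [ha, hb]
  · right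
    have hb : β = -1 := by linear_combination hβ
    have ha : α = X.trace := hα' _ (by rw [hα, hb]; ring)
    rw [ha, hb, add_mul, smul_mul_assoc, smul_mul_assoc, sq_fin_two, hXd]
    simp

theorem Matrix.pow_char_of_trace_eq {k : Type*} [Field k] {p : ℕ} [Fact p.Prime] [CharP k p]
    {X : Matrix (Fin 2) (Fin 2) k} {ε : k} (hε : ε ^ 2 = 1) (hd : X.det = 1)
    (ht : X.trace = 2 * ε) : X ^ p = ε ^ p • 1 := by
  have hp2 : 2 ≤ p := (Fact.out : p.Prime).two_le
  have hc : Commute X (ε • 1) := (Commute.one_right X).smul_right ε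
  have hsq : (X - ε • 1) ^ 2 = 0 := by
    rw [sq, sub_mul, mul_sub, mul_sub, sq_fin_two, hd, ht]
    simp only [← sq, smul_pow, hε, mul_smul_comm, smul_mul_assoc, one_mul, mul_one,
      two_mul, add_smul, one_pow, one_smul]
    abel
  have := sub_pow_expChar_of_commute p hc
  rw [pow_eq_zero_of_le hp2 hsq, smul_pow, one_pow] at this
  exact (sub_eq_zero.1 this.symm)

/-- If `N(P) ≤ C(P)` for all Sylow subgroups at primes other than `p`, then the commutator
subgroup is a `p`-group. -/
theorem isPGroup_commutator_of_normalizer_le_centralizer {G : Type*} [Group G] [Finite G] {p : ℕ}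
    (h : ∀ (q : ℕ) [Fact q.Prime] (P : Sylow q G), q ≠ p →
      Subgroup.normalizer P ≤ Subgroup.centralizer (P : Set G)) :
    IsPGroup p (commutator G) := by
  refine IsPGroup.of_card (n := _) (Nat.eq_prime_pow_of_unique_prime_dvd Nat.card_pos.ne' ?_)
  intro q hq hdvd
  by_contra hqp
  have := Fact.mk hq
  let P : Sylow q G := default
  have hP := h q P hqp
  refine MonoidHom.not_dvd_card_ker_transferSylow P hP
    (hdvd.trans (Subgroup.card_dvd_of_le ?_))
  rw [commutator_def, Subgroup.commutator_le]
  intro a _ b _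
  rw [MonoidHom.mem_ker, map_commutatorElement, commutatorElement_eq_one_iff_mul_comm]
  exact Subtype.ext (hP (Subgroup.le_normalizer (SetLike.coe_mem (MonoidHom.transferSylow P hP b)))
    _ (SetLike.coe_mem _))

/-- A root of a quadratic polynomial over a finite field with `q` elements, in a possibly
noncommutative algebra, is mapped by the `q`-power Frobenius to itself or to its conjugate, up to
zero divisors. -/
theorem FiniteField.pow_card_sub_mul_pow_card_sub_eq_zero {k R : Type*} [Field k] [Fintype k]
    [Ring R] [Nontrivial R] [Algebra k R] {x : R} {t d : k} (hx : x * x = t • x - d • 1) :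
    (x ^ Fintype.card k - x) * (x ^ Fintype.card k - (t • 1 - x)) = 0 := by
  obtain ⟨p, _⟩ := CharP.exists k
  obtain ⟨n, hp, hn⟩ := FiniteField.card k p
  have := Fact.mk hp
  have : CharP R p := charP_of_injective_algebraMap (algebraMap k R).injective p
  set y := t • 1 - x with hy
  have hxy : x * y = d • 1 := by rw [hy, mul_sub, hx]; simp
  have hc : Commute x y := ((Commute.one_right x).smul_right t).sub_right (Commute.refl x)
  have hadd : x ^ Fintype.card k + y ^ Fintype.card k = t • 1 := by
    rw [hn, ← add_pow_expChar_pow_of_commute p _ hc, ← hn, hy, add_sub_cancel, smul_pow, one_pow,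
      FiniteField.pow_card]
  have hmul : x ^ Fintype.card k * y ^ Fintype.card k = d • 1 := by
    rw [← hc.mul_pow, hxy, smul_pow, one_pow, FiniteField.pow_card]
  have hcx : x * x ^ Fintype.card k = x ^ Fintype.card k * x := (Commute.refl x).pow_right _
  calc _ = x ^ Fintype.card k * (x ^ Fintype.card k - (y + x)) + x * y := by
        simp only [sub_mul, mul_sub, mul_add, hcx]; abel
    _ = x ^ Fintype.card k * (x ^ Fintype.card k - (x ^ Fintype.card k + y ^ Fintype.card k))
          + d • 1 := by rw [hadd, hxy, hy, sub_add_cancel]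
    _ = 0 := by rw [sub_add_cancel_left, mul_neg, hmul, neg_add_cancel]

open Polynomial in
theorem Matrix.exists_det_sub_smul_one_eq_zero {k : Type*} [Field k] [Fintype k]
    {ι : Type*} [Fintype ι] [DecidableEq ι] [Nonempty ι] {X : Matrix ι ι k}
    (hX : X ^ Fintype.card k = X) : ∃ c : k, (X - c • 1).det = 0 := by
  have hprod : (Finset.univ.val.map fun a : k => (Polynomial.X - C a : k[X])).prod =
      Polynomial.X ^ Fintype.card k - Polynomial.X := by
    rw [← FiniteField.roots_X_pow_card_sub_X]
    refine prod_multiset_X_sub_C_of_monic_of_roots_card_eq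
      (monic_X_pow_sub (by simpa using Fintype.one_lt_card)) ?_
    rw [FiniteField.roots_X_pow_card_sub_X,
      FiniteField.X_pow_card_sub_X_natDegree_eq k Fintype.one_lt_card]
    rfl
  let D : k[X] →* k := Matrix.detMonoidHom.comp (MonoidHomClass.toMonoidHom (aeval (R := k) X))
  have hD : D (Polynomial.X ^ Fintype.card k - Polynomial.X) = 0 := by simp [D, hX]
  rw [← hprod, map_multiset_prod, Multiset.map_map, Multiset.prod_eq_zero_iff,
    Multiset.mem_map] at hD
  obtain ⟨c, -, hc⟩ := hD
  exact ⟨c, by simpa [D, Algebra.algebraMap_eq_smul_one] using hc⟩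

theorem Matrix.det_add_smul_fin_two {R : Type*} [CommRing R] (X : Matrix (Fin 2) (Fin 2) R)
    (α β : R) : (α • 1 + β • X).det = α ^ 2 + α * β * X.trace + β ^ 2 * X.det := by
  simp [Matrix.trace_fin_two, Matrix.det_fin_two]
  ring

/-- The elements on which a matrix representation has determinant one. -/
def detKer {k G : Type*} [Field k] [Group G] (ρ : G →* Matrix (Fin 2) (Fin 2) k) : Subgroup G :=
  (Matrix.detMonoidHom.comp ρ).ker

theorem mem_detKer {k G : Type*} [Field k] [Group G] {ρ : G →* Matrix (Fin 2) (Fin 2) k} {g : G} :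
    g ∈ detKer ρ ↔ (ρ g).det = 1 :=
  Iff.rfl

instance {k G : Type*} [Field k] [Group G] (ρ : G →* Matrix (Fin 2) (Fin 2) k) :
    (detKer ρ).Normal :=
  MonoidHom.normal_ker _

/-- A matrix representation of degree two with no nontrivial scalar values, whose nonzero
endomorphisms are invertible, and whose group has no nontrivial normal `p`-subgroup. -/
structure IsScalarFreeIrreducible {k G : Type*} [Field k] [Group G] (p : ℕ)
    (ρ : G →* Matrix (Fin 2) (Fin 2) k) : Prop where
  eq_one_of_eq_smul_one : ∀ (g : G) (c : k), ρ g = c • 1 → g = 1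
  eq_zero_of_commute : ∀ T : Matrix (Fin 2) (Fin 2) k, (∀ g, Commute T (ρ g)) → T.det = 0 → T = 0
  eq_bot_of_isPGroup : ∀ N : Subgroup G, N.Normal → IsPGroup p N → N = ⊥

namespace IsScalarFreeIrreducible

variable {k G : Type*} [Field k] [Group G] {p : ℕ} {ρ : G →* Matrix (Fin 2) (Fin 2) k}

theorem injective (h : IsScalarFreeIrreducible p ρ) : Function.Injective ρ := by
  rw [injective_iff_map_eq_one]
  exact fun g hg => h.eq_one_of_eq_smul_one g 1 (by simpa using hg)

theorem commute_map_iff (h : IsScalarFreeIrreducible p ρ) {x y : G} :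
    Commute (ρ x) (ρ y) ↔ Commute x y :=
  ⟨fun hc => h.injective (by simpa using hc.eq), fun hc => hc.map ρ⟩

theorem scalar_eq_one (h : IsScalarFreeIrreducible p ρ) {g : G} {c : k} (hg : ρ g = c • 1) :
    c = 1 := by
  have h1 := h.eq_one_of_eq_smul_one g c hg
  rw [h1, map_one] at hg
  simpa using (congrFun₂ hg 0 0).symm

theorem commute_of_commute (h : IsScalarFreeIrreducible p ρ) {g x y : G} (hg : g ≠ 1)
    (hx : Commute g x) (hy : Commute g y) : Commute x y :=
  h.commute_map_iff.1 <| Matrix.commute_of_commute_of_ne_smul_one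
    (fun c hc => hg (h.eq_one_of_eq_smul_one g c hc)) (hx.map ρ) (hy.map ρ)

theorem eq_one_of_sq_eq_one (h : IsScalarFreeIrreducible p ρ) (h2 : (2 : k) ≠ 0) {g : G}
    (hg : g ∈ detKer ρ) (hsq : g ^ 2 = 1) : g = 1 := by
  have hch := Matrix.sq_fin_two (ρ g)
  rw [mem_detKer.1 hg, ← map_mul, ← sq, hsq, map_one, one_smul] at hch
  have hch : (ρ g).trace • ρ g = (2 : k) • 1 := by
    rw [two_smul]; exact (eq_sub_iff_add_eq.1 hch).symm
  have ht : (ρ g).trace ≠ 0 := by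
    intro ht
    apply h2
    have := congrFun₂ hch 0 0
    rw [ht] at this
    simpa using this.symm
  refine h.eq_one_of_eq_smul_one g ((ρ g).trace⁻¹ * 2) ?_
  rw [mul_smul, ← hch, inv_smul_smul₀ ht]

theorem odd_card_detKer [Finite G] (h : IsScalarFreeIrreducible p ρ) (h2 : (2 : k) ≠ 0) :
    Odd (Nat.card (detKer ρ)) := by
  rw [← Nat.not_even_iff_odd, even_iff_two_dvd]
  intro hdvd
  obtain ⟨x, hx⟩ := exists_prime_orderOf_dvd_card' 2 hdvd
  have h1 : (x : G) = 1 := h.eq_one_of_sq_eq_one h2 x.2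
    (by rw [← Subgroup.coe_pow, ← hx, pow_orderOf_eq_one, Subgroup.coe_one])
  rw [Subtype.ext (a1 := x) (a2 := 1) h1, orderOf_one] at hx
  omega

theorem pow_char_eq_one [Fact p.Prime] [CharP k p] (h : IsScalarFreeIrreducible p ρ)
    (h2 : (2 : k) ≠ 0) {g : G} (hg : g ∈ detKer ρ) (ht : (ρ g).trace ^ 2 = 4) : g ^ p = 1 := by
  refine h.eq_one_of_eq_smul_one _ (((ρ g).trace / 2) ^ p) ?_
  rw [map_pow]
  refine Matrix.pow_char_of_trace_eq ?_ hg (by field_simp)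
  rw [div_pow, ht]
  field_simp
  norm_num

theorem conj_eq_or_eq_inv (h : IsScalarFreeIrreducible p ρ) (h2 : (2 : k) ≠ 0) {x : G}
    (hx : x ∈ detKer ρ) (ht : (ρ x).trace ^ 2 ≠ 4) (g : G) (hc : Commute x (g * x * g⁻¹)) :
    g * x * g⁻¹ = x ∨ g * x * g⁻¹ = x⁻¹ := by
  have htr : (ρ x).trace = (ρ (g * x * g⁻¹)).trace := by
    rw [map_mul, Matrix.trace_mul_comm, ← map_mul, ← mul_assoc, inv_mul_cancel,
      one_mul]
  rcases Matrix.eq_or_mul_eq_one_of_commute h2 hx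
    ((inferInstance : (detKer ρ).Normal).conj_mem x hx g) htr ht (hc.map ρ) with h1 | h1
  · exact Or.inl (h.injective h1)
  · rw [← map_mul, ← map_one ρ] at h1
    exact Or.inr (eq_inv_of_mul_eq_one_left (h.injective h1))

theorem normalizer_le_centralizer [Finite G] [Fact p.Prime] [CharP k p]
    (h : IsScalarFreeIrreducible p ρ) (h2 : (2 : k) ≠ 0) {q : ℕ} [Fact q.Prime] (hqp : q ≠ p)
    (P : Sylow q (detKer ρ)) :
    Subgroup.normalizer P ≤ Subgroup.centralizer (P : Set (detKer ρ)) := by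
  intro n hn x hx
  by_cases hx1 : x = 1
  · simp [hx1]
  have hxord : ¬ x ^ p = 1 := by
    intro hxp
    obtain ⟨m, hm⟩ := P.2 ⟨x, hx⟩
    have hm : x ^ q ^ m = 1 := congrArg Subtype.val hm
    have hcop : (q ^ m).Coprime p :=
      Nat.Coprime.pow_left m ((Nat.coprime_primes Fact.out Fact.out).2 hqp)
    have := pow_gcd_eq_one.2 ⟨hm, hxp⟩
    rw [hcop] at this
    exact hx1 (by simpa using this)
  have ht : (ρ x).trace ^ 2 ≠ 4 := fun ht =>
    hxord (Subtype.ext (by simpa using h.pow_char_eq_one h2 x.2 ht))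
  have : Nontrivial P := ⟨⟨⟨x, hx⟩, 1, fun he => hx1 (congrArg Subtype.val he)⟩⟩
  have := P.2.center_nontrivial
  obtain ⟨⟨z, hz⟩, hz1⟩ := exists_ne (1 : Subgroup.center P)
  have hz0 : ((z : detKer ρ) : G) ≠ 1 := fun he => hz1 (Subtype.ext (Subtype.ext (Subtype.ext he)))
  have hzc (y : detKer ρ) (hy : y ∈ P) : Commute ((z : detKer ρ) : G) (y : G) :=
    (congrArg (fun w : P => ((w : detKer ρ) : G)) (Subgroup.mem_center_iff.1 hz ⟨y, hy⟩)).symm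
  have hcx : Commute (x : G) (n * x * (n : G)⁻¹) :=
    h.commute_of_commute hz0 (hzc x hx)
      (hzc (n * x * n⁻¹) ((Subgroup.mem_normalizer_iff.1 hn x).1 hx))
  have hn2 : Commute (x : G) ((n : G) ^ 2) := by
    rcases h.conj_eq_or_eq_inv h2 x.2 ht n hcx with h1 | h1
    · have : Commute (n : G) x := mul_inv_eq_iff_eq_mul.1 h1
      exact (this.pow_left 2).symm
    · have h3 : (n : G) * x = (x : G)⁻¹ * n := mul_inv_eq_iff_eq_mul.1 h1
      have h4 : (n : G) * (x : G)⁻¹ = x * n := by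
        have := congrArg (·⁻¹) h1
        rw [mul_inv_rev, mul_inv_rev, inv_inv, inv_inv, ← mul_assoc] at this
        exact mul_inv_eq_iff_eq_mul.1 this
      change (x : G) * n ^ 2 = n ^ 2 * x
      rw [sq, mul_assoc, h3, ← mul_assoc, ← mul_assoc, h4]
  have hodd : Odd (orderOf n) := (h.odd_card_detKer h2).of_dvd_nat (orderOf_dvd_natCard n)
  obtain ⟨m, hm⟩ := hodd
  have hnm : n = (n ^ 2) ^ (m + 1) := by
    rw [← pow_mul, show 2 * (m + 1) = 2 * m + 1 + 1 by ring, ← hm, pow_succ, pow_orderOf_eq_one,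
      one_mul]
  have : Commute x n := by
    rw [hnm]
    exact Commute.pow_right (Subtype.ext hn2.eq) _
  exact this

open scoped commutatorElement in
theorem commute_of_mem_detKer [Finite G] [Fact p.Prime] [CharP k p]
    (h : IsScalarFreeIrreducible p ρ) (h2 : (2 : k) ≠ 0) {x y : G} (hx : x ∈ detKer ρ)
    (hy : y ∈ detKer ρ) : Commute x y := by
  have hp : IsPGroup p (commutator (detKer ρ)) :=
    isPGroup_commutator_of_normalizer_le_centralizer fun q _ P hq =>
      h.normalizer_le_centralizer h2 hq P
  have hbot := h.eq_bot_of_isPGroup ((commutator (detKer ρ)).map (detKer ρ).subtype)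
    inferInstance (hp.map _)
  rw [Subgroup.map_eq_bot_iff_of_injective _ (Subgroup.subtype_injective _)] at hbot
  have : ⁅(⟨x, hx⟩ : detKer ρ), ⟨y, hy⟩⁆ ∈ commutator (detKer ρ) :=
    Subgroup.commutator_mem_commutator (Subgroup.mem_top _) (Subgroup.mem_top _)
  rw [hbot, Subgroup.mem_bot, commutatorElement_eq_one_iff_mul_comm] at this
  exact congrArg Subtype.val this

theorem not_dvd_card_detKer [Finite G] [Fact p.Prime] [CharP k p]
    (h : IsScalarFreeIrreducible p ρ) (h2 : (2 : k) ≠ 0) : ¬ p ∣ Nat.card (detKer ρ) := by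
  intro hdvd
  let P : Sylow p (detKer ρ) := default
  have hn : (P : Subgroup (detKer ρ)).Normal := ⟨fun x hx g => by
    have : g * x = x * g := Subtype.ext (h.commute_of_mem_detKer h2 g.2 x.2).eq
    rwa [this, mul_inv_cancel_right]⟩
  have := P.characteristic_of_normal hn
  have hbot := h.eq_bot_of_isPGroup ((P : Subgroup (detKer ρ)).map (detKer ρ).subtype)
    inferInstance (P.2.map _)
  rw [Subgroup.map_eq_bot_iff_of_injective _ (Subgroup.subtype_injective _)] at hbot
  exact P.ne_bot_of_dvd_card hdvd hbot

theorem eq_one_of_trace_sq [Finite G] [Fact p.Prime] [CharP k p]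
    (h : IsScalarFreeIrreducible p ρ) (h2 : (2 : k) ≠ 0) {g : G} (hg : g ∈ detKer ρ)
    (ht : (ρ g).trace ^ 2 = 4) : g = 1 := by
  by_contra hg1
  have hord := orderOf_eq_prime (h.pow_char_eq_one h2 hg ht) hg1
  apply h.not_dvd_card_detKer h2
  rw [← hord, ← Subgroup.orderOf_mk g hg]
  exact orderOf_dvd_natCard _

theorem exists_ne_one (h : IsScalarFreeIrreducible p ρ) : ∃ g : G, g ≠ 1 := by
  by_contra! hg
  have := h.eq_zero_of_commute !![1, 0; 0, 0] (fun g => by rw [hg g, map_one]; exact .one_right _)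
    (by simp)
  simpa using congrFun₂ this 0 0

theorem mem_detKer_and_pow_eq_one_of_comm [Fintype k] (h : IsScalarFreeIrreducible p ρ)
    (hG : ∀ x y : G, Commute x y) (g : G) : g ∈ detKer ρ ∧ g ^ (Fintype.card k + 1) = 1 := by
  have hc (x : G) : Commute (ρ g) (ρ x) := (hG g x).map ρ
  have hmul := FiniteField.pow_card_sub_mul_pow_card_sub_eq_zero (Matrix.sq_fin_two (ρ g))
  have hdet := congrArg Matrix.det hmul
  rw [Matrix.det_mul, Matrix.det_zero, mul_eq_zero] at hdet
  rcases hdet with h1 | h1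
  · have h1 := h.eq_zero_of_commute _ (fun x => ((hc x).pow_left _).sub_left (hc x)) h1
    obtain ⟨c, hc'⟩ := Matrix.exists_det_sub_smul_one_eq_zero (sub_eq_zero.1 h1)
    have h2 := h.eq_zero_of_commute _
      (fun x => (hc x).sub_left ((Commute.one_left _).smul_left c)) hc'
    have := h.eq_one_of_eq_smul_one g c (sub_eq_zero.1 h2)
    simp [this, one_mem]
  · have h1 := h.eq_zero_of_commute _ (fun x => ((hc x).pow_left _).sub_left
      (((Commute.one_left _).smul_left _).sub_left (hc x))) h1
    have h2 : ρ (g ^ (Fintype.card k + 1)) = (ρ g).det • 1 := by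
      rw [map_pow, pow_succ, sub_eq_zero.1 h1, sub_mul, Matrix.sq_fin_two]
      simp
    exact ⟨h.scalar_eq_one h2, h.eq_one_of_eq_smul_one _ _ h2⟩

theorem exists_mem_detKer_ne_one [Fintype k] (h : IsScalarFreeIrreducible p ρ) :
    ∃ a ∈ detKer ρ, a ≠ 1 := by
  by_contra! hA
  obtain ⟨g, hg⟩ := h.exists_ne_one
  refine hg (hA g (h.mem_detKer_and_pow_eq_one_of_comm (fun x y => ?_) g).1)
  have : (x * y) * (y * x)⁻¹ = 1 := hA _ <| by
    rw [mem_detKer, map_mul, Matrix.det_mul,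
      show (ρ (x * y)).det = (ρ (y * x)).det by simp [mul_comm], ← Matrix.det_mul, ← map_mul]
    simp
  exact mul_inv_eq_one.1 this

open scoped Matrix in
theorem exists_injective_character [Finite G] [Fact p.Prime] [CharP k p]
    (h : IsScalarFreeIrreducible p ρ) (h2 : (2 : k) ≠ 0) {a : G} (ha : a ∈ detKer ρ)
    (ha1 : a ≠ 1) : ∃ χ : detKer ρ →* AlgebraicClosure k, Function.Injective χ ∧
      ∀ x, χ x * χ x = (ρ x).trace • χ x - (1 : k) • 1 := by
  let K := AlgebraicClosure k
  let φ : Matrix (Fin 2) (Fin 2) k →ₐ[k] Matrix (Fin 2) (Fin 2) K :=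
    (Algebra.ofId k K).mapMatrix
  obtain ⟨μ, hμ⟩ := Module.End.exists_eigenvalue (Matrix.toLin' (φ (ρ a)))
  obtain ⟨v, hv⟩ := hμ.exists_hasEigenvector
  have hv0 : v ≠ 0 := hv.2
  have hav : φ (ρ a) *ᵥ v = μ • v := hv.apply_eq_smul
  have hinj {c d : K} (hcd : c • v = d • v) : c = d := smul_left_injective K hv0 hcd
  have hex (x : detKer ρ) : ∃ c : K, φ (ρ x) *ᵥ v = c • v := by
    obtain ⟨α, β, hαβ⟩ := Matrix.exists_eq_add_smul_of_commute
      (fun c hc => ha1 (h.eq_one_of_eq_smul_one a c hc))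
      ((h.commute_of_mem_detKer h2 ha x.2).map ρ)
    refine ⟨algebraMap k K α + β • μ, ?_⟩
    rw [hαβ, map_add, map_smul, map_smul, map_one, Matrix.add_mulVec, Matrix.smul_mulVec,
      Matrix.smul_mulVec, Matrix.one_mulVec, hav, add_smul, algebraMap_smul, smul_assoc]
  choose χ hχ using hex
  have hquad (x : detKer ρ) : χ x * χ x = (ρ x).trace • χ x - (1 : k) • 1 := by
    apply hinj
    have := congrArg (fun M => φ M *ᵥ v) (Matrix.sq_fin_two (ρ x))
    simp only [map_mul, map_sub, map_smul, map_one, Matrix.sub_mulVec, Matrix.smul_mulVec,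
      Matrix.one_mulVec, ← Matrix.mulVec_mulVec, hχ, Matrix.mulVec_smul, mem_detKer.1 x.2] at this
    rw [mul_smul, this, sub_smul, smul_assoc, smul_assoc, one_smul K v]
  let χ' : detKer ρ →* K :=
    { toFun := χ
      map_one' := hinj <| by rw [← hχ]; simp
      map_mul' := fun x y => hinj <| by
        rw [← hχ, Subgroup.coe_mul, map_mul, map_mul, ← Matrix.mulVec_mulVec, hχ,
          Matrix.mulVec_smul, hχ, smul_smul, mul_comm] }
  refine ⟨χ', (injective_iff_map_eq_one χ').2 fun x hx => ?_, hquad⟩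
  have hq := hquad x
  rw [show χ x = 1 from hx, Algebra.smul_def, one_smul, mul_one, mul_one] at hq
  refine Subtype.ext (h.eq_one_of_trace_sq h2 x.2 ?_)
  apply (algebraMap k K).injective
  rw [map_pow, show algebraMap k K (ρ x).trace = 2 by linear_combination -hq,
    map_ofNat]
  norm_num

theorem isCyclic_detKer [Fintype k] [Finite G] [Fact p.Prime] [CharP k p]
    (h : IsScalarFreeIrreducible p ρ) (h2 : (2 : k) ≠ 0) :
    IsCyclic (detKer ρ) := by
  obtain ⟨a, ha, ha1⟩ := h.exists_mem_detKer_ne_one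
  obtain ⟨χ, hχ, -⟩ := h.exists_injective_character h2 ha ha1
  exact isCyclic_of_injective_ringHom χ hχ

theorem card_detKer_dvd [Fintype k] [Finite G] [Fact p.Prime] [CharP k p]
    (h : IsScalarFreeIrreducible p ρ) (h2 : (2 : k) ≠ 0) :
    Nat.card (detKer ρ) ∣ Fintype.card k - 1 ∨ Nat.card (detKer ρ) ∣ Fintype.card k + 1 := by
  obtain ⟨a, ha, ha1⟩ := h.exists_mem_detKer_ne_one
  obtain ⟨χ, hχ, hquad⟩ := h.exists_injective_character h2 ha ha1
  obtain ⟨g, hg⟩ := (h.isCyclic_detKer h2).exists_generator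
  rw [← orderOf_eq_card_of_forall_mem_zpowers hg, orderOf_dvd_iff_pow_eq_one,
    orderOf_dvd_iff_pow_eq_one]
  have hmul := FiniteField.pow_card_sub_mul_pow_card_sub_eq_zero (hquad g)
  have hinv : ((ρ g).trace • 1 - χ g) * χ g = 1 := by
    rw [sub_mul, hquad, one_smul, smul_mul_assoc, one_mul]
    ring
  have hχ0 : χ g ≠ 0 := right_ne_zero_of_mul_eq_one hinv
  refine (mul_eq_zero.1 hmul).imp (fun h1 => hχ ?_) (fun h1 => hχ ?_)
  · rw [map_pow, map_one]
    apply mul_right_cancel₀ hχ0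
    rw [← pow_succ, Nat.sub_add_cancel Fintype.card_pos, one_mul]
    exact sub_eq_zero.1 h1
  · rw [map_pow, map_one, pow_succ, sub_eq_zero.1 h1, hinv]

theorem mem_detKer_of_commute [Fintype k] [Finite G] [Fact p.Prime] [CharP k p]
    (h : IsScalarFreeIrreducible p ρ) (h2 : (2 : k) ≠ 0) {a s : G} (ha : a ∈ detKer ρ)
    (ha1 : a ≠ 1) (hs : Commute a s) : s ∈ detKer ρ := by
  by_cases hall : ∀ g, Commute a g
  · exact (h.mem_detKer_and_pow_eq_one_of_comm
      (fun x y => h.commute_of_commute ha1 (hall x) (hall y)) s).1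
  push Not at hall
  obtain ⟨g, hg⟩ := hall
  have hga : g * a * g⁻¹ = a⁻¹ := by
    refine (h.conj_eq_or_eq_inv h2 ha (fun ht => ha1 (h.eq_one_of_trace_sq h2 ha ht)) g
      (h.commute_of_mem_detKer h2 ha ?_)).resolve_left ?_
    · exact (inferInstance : (detKer ρ).Normal).conj_mem a ha g
    · intro h1
      exact hg (Commute.symm (mul_inv_eq_iff_eq_mul.1 h1))
  obtain ⟨α, β, hαβ⟩ := Matrix.exists_eq_add_smul_of_commute
    (fun c hc => ha1 (h.eq_one_of_eq_smul_one a c hc)) (hs.map ρ)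
  have hinv : ρ a⁻¹ = (ρ a).trace • 1 - ρ a := by
    have h1 : ((ρ a).trace • 1 - ρ a) * ρ a = 1 := by
      rw [sub_mul, Matrix.sq_fin_two, mem_detKer.1 ha]; simp
    calc ρ a⁻¹ = ((ρ a).trace • 1 - ρ a) * ρ a * ρ a⁻¹ := by rw [h1, one_mul]
      _ = _ := by rw [mul_assoc, ← map_mul, mul_inv_cancel, map_one, mul_one]
  have hgs : ρ (g * s * g⁻¹) = α • 1 + β • ((ρ a).trace • 1 - ρ a) := by
    rw [← hinv, ← hga]
    simp only [map_mul, hαβ, mul_add, add_mul, mul_smul_comm, smul_mul_assoc, mul_one]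
    rw [← map_mul, mul_inv_cancel, map_one]
  have hprod : ρ (s * (g * s * g⁻¹)) = (ρ s).det • 1 := by
    rw [map_mul, hgs, hαβ, Matrix.det_add_smul_fin_two, mem_detKer.1 ha]
    simp only [add_mul, mul_add, mul_sub, smul_sub, mul_smul_comm, smul_mul_assoc, one_mul,
      mul_one, Matrix.sq_fin_two, mem_detKer.1 ha, smul_smul, add_smul]
    module
  exact h.scalar_eq_one hprod

theorem conj_eq_inv_of_notMem [Fintype k] [Finite G] [Fact p.Prime] [CharP k p]
    (h : IsScalarFreeIrreducible p ρ) (h2 : (2 : k) ≠ 0) {a s : G} (ha : a ∈ detKer ρ)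
    (hs : s ∉ detKer ρ) : s * a * s⁻¹ = a⁻¹ := by
  by_cases ha1 : a = 1
  · simp [ha1]
  refine (h.conj_eq_or_eq_inv h2 ha (fun ht => ha1 (h.eq_one_of_trace_sq h2 ha ht)) s
    (h.commute_of_mem_detKer h2 ha ?_)).resolve_left fun h1 => ?_
  · exact (inferInstance : (detKer ρ).Normal).conj_mem a ha s
  · exact hs (h.mem_detKer_of_commute h2 ha ha1 (Commute.symm (mul_inv_eq_iff_eq_mul.1 h1)))

theorem mul_mem_detKer_of_notMem [Fintype k] [Finite G] [Fact p.Prime] [CharP k p]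
    (h : IsScalarFreeIrreducible p ρ) (h2 : (2 : k) ≠ 0) {s t : G}
    (hs : s ∉ detKer ρ) (ht : t ∉ detKer ρ) : s * t ∈ detKer ρ := by
  obtain ⟨a, ha, ha1⟩ := h.exists_mem_detKer_ne_one
  refine h.mem_detKer_of_commute h2 ha ha1 (Commute.symm ?_)
  have h1 := h.conj_eq_inv_of_notMem h2 ha ht
  have h3 := h.conj_eq_inv_of_notMem h2 (inv_mem ha) hs
  refine mul_inv_eq_iff_eq_mul.1 ?_
  calc s * t * a * (s * t)⁻¹ = s * (t * a * t⁻¹) * s⁻¹ := by group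
    _ = a := by rw [h1, h3, inv_inv]

theorem sq_eq_one_of_notMem [Fintype k] [Finite G] [Fact p.Prime] [CharP k p]
    (h : IsScalarFreeIrreducible p ρ) (h2 : (2 : k) ≠ 0) {s : G}
    (hs : s ∉ detKer ρ) : s ^ 2 = 1 := by
  by_contra h1
  refine hs (h.mem_detKer_of_commute h2 ?_ h1 ((Commute.refl s).pow_left 2))
  rw [sq]
  exact h.mul_mem_detKer_of_notMem h2 hs hs

theorem index_detKer_le_two [Fintype k] [Finite G] [Fact p.Prime] [CharP k p]
    (h : IsScalarFreeIrreducible p ρ) (h2 : (2 : k) ≠ 0) : (detKer ρ).index ≤ 2 := by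
  by_cases hall : ∀ g, g ∈ detKer ρ
  · rw [(Subgroup.eq_top_iff' _).2 hall, Subgroup.index_top]
    exact one_le_two
  push Not at hall
  obtain ⟨s, hs⟩ := hall
  refine (Subgroup.index_eq_two_iff.2 ⟨s, fun b => ?_⟩).le
  by_cases hb : b ∈ detKer ρ
  · exact Or.inr ⟨hb, fun h1 => hs ((Subgroup.mul_mem_cancel_left _ hb).1 h1)⟩
  · exact Or.inl ⟨h.mul_mem_detKer_of_notMem h2 hb hs, hb⟩

end IsScalarFreeIrreducible

/-- The matrix representation of a subgroup of `GL(V)` in a given basis. -/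
noncomputable def matrixRep {k V ι : Type*} [Field k] [AddCommGroup V] [Module k V] [Fintype ι]
    [DecidableEq ι] (b : Module.Basis ι k V) (H : Subgroup (V ≃ₗ[k] V)) : H →* Matrix ι ι k :=
  ((LinearMap.toMatrixAlgEquiv b : (V →ₗ[k] V) ≃* Matrix ι ι k).toMonoidHom.comp
    (LinearEquiv.automorphismGroup.toLinearMapMonoidHom (R := k) (M := V))).comp H.subtype

theorem matrixRep_apply {k V ι : Type*} [Field k] [AddCommGroup V] [Module k V] [Fintype ι]
    [DecidableEq ι] (b : Module.Basis ι k V) {H : Subgroup (V ≃ₗ[k] V)} (g : H) :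
    matrixRep b H g = LinearMap.toMatrixAlgEquiv b ((g : V ≃ₗ[k] V) : V →ₗ[k] V) :=
  rfl

theorem det_matrixRep {k V ι : Type*} [Field k] [AddCommGroup V] [Module k V] [Fintype ι]
    [DecidableEq ι] (b : Module.Basis ι k V) {H : Subgroup (V ≃ₗ[k] V)} (g : H) :
    (matrixRep b H g).det = (LinearEquiv.det (g : V ≃ₗ[k] V) : kˣ) := by
  rw [matrixRep_apply, LinearEquiv.coe_det]
  exact LinearMap.det_toMatrix b _

/-- A normal `p`-subgroup of a group acting irreducibly on a finite vector space of
characteristic `p` is trivial. -/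
theorem Subgroup.eq_bot_of_isPGroup_of_irreducible {k V : Type*} [Field k] [AddCommGroup V]
    [Module k V] [Finite V] [Nontrivial V] {p : ℕ} [Fact p.Prime] [CharP k p]
    {H : Subgroup (V ≃ₗ[k] V)}
    (hirr : ∀ W : Submodule k V, (∀ g ∈ H, ∀ v ∈ W, g v ∈ W) → W = ⊥ ∨ W = ⊤)
    {N : Subgroup H} (hN : N.Normal) (hp : IsPGroup p N) : N = ⊥ := by
  let W : Submodule k V :=
    { carrier := {v | ∀ n ∈ N, (n : V ≃ₗ[k] V) v = v}
      add_mem' := fun hv hw n hn => by rw [map_add, hv n hn, hw n hn]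
      zero_mem' := fun n _ => map_zero _
      smul_mem' := fun c v hv n hn => by rw [map_smul, hv n hn] }
  have hW : W = ⊥ ∨ W = ⊤ := by
    refine hirr W fun g hg v hv n hn => ?_
    have h1 := hv _ (hN.conj_mem n hn (⟨g, hg⟩⁻¹ : H))
    rw [inv_inv] at h1
    have h2 := congrArg g h1
    change g (g⁻¹ ((n : V ≃ₗ[k] V) (g v))) = g v at h2
    rwa [← LinearEquiv.mul_apply, mul_inv_cancel] at h2
  have hdvd : p ∣ Nat.card V := by
    obtain ⟨v, hv⟩ := exists_ne (0 : V)
    have : addOrderOf v = p := addOrderOf_eq_prime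
      (by rw [← Nat.cast_smul_eq_nsmul k, CharP.cast_eq_zero, zero_smul]) hv
    rw [← this]
    exact addOrderOf_dvd_natCard v
  obtain ⟨v, hv, hv0⟩ := hp.exists_fixed_point_of_prime_dvd_card_of_fixed_point V hdvd (a := 0)
    (fun n => map_zero ((n : H) : V ≃ₗ[k] V))
  have hWtop : W = ⊤ := hW.resolve_left fun hbot => hv0.symm <| by
    rw [← Submodule.mem_bot k, ← hbot]
    exact fun n hn => hv ⟨n, hn⟩
  refine (Subgroup.eq_bot_iff_forall N).2 fun n hn => Subtype.ext (LinearEquiv.ext fun v => ?_)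
  exact (hWtop ▸ Submodule.mem_top : v ∈ W) n hn

theorem isScalarFreeIrreducible_matrixRep {k V : Type*} [Field k] [AddCommGroup V]
    [Module k V] [Finite V] {p : ℕ} [Fact p.Prime] [CharP k p]
    (b : Module.Basis (Fin 2) k V) {H : Subgroup (V ≃ₗ[k] V)}
    (hirr : ∀ W : Submodule k V, (∀ g ∈ H, ∀ v ∈ W, g v ∈ W) → W = ⊥ ∨ W = ⊤)
    (hhom : ∀ g ∈ H, ∀ c : k, (∀ v : V, g v = c • v) → c = 1) :
    IsScalarFreeIrreducible p (matrixRep b H) where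
  eq_one_of_eq_smul_one g c hg := by
    rw [matrixRep_apply, ← map_one (LinearMap.toMatrixAlgEquiv b), ← map_smul] at hg
    have hg (v : V) : (g : V ≃ₗ[k] V) v = c • v :=
      LinearMap.congr_fun ((LinearMap.toMatrixAlgEquiv b).injective hg) v
    have hc := hhom g g.2 c hg
    exact Subtype.ext (LinearEquiv.ext fun v => by rw [hg, hc, one_smul]; rfl)
  eq_zero_of_commute T hT hdet := by
    obtain ⟨f, rfl⟩ := (LinearMap.toMatrixAlgEquiv b).surjective T
    have hf (g) (hg : g ∈ H) (v : V) : f (g v) = g (f v) := by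
      have := hT ⟨g, hg⟩
      rw [matrixRep_apply, Commute, SemiconjBy, ← map_mul, ← map_mul] at this
      exact LinearMap.congr_fun ((LinearMap.toMatrixAlgEquiv b).injective this) v
    have hker : LinearMap.ker f ≠ ⊥ :=
      (LinearMap.bot_lt_ker_of_det_eq_zero ((LinearMap.det_toMatrix b f).symm.trans hdet)).ne'
    have := (hirr (LinearMap.ker f) fun g hg v hv => by
      rw [LinearMap.mem_ker] at hv ⊢
      rw [hf g hg, hv, map_zero]).resolve_left hker
    rw [LinearMap.ker_eq_top.1 this, map_zero]
  eq_bot_of_isPGroup N hN hp :=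
    have : Nontrivial V := b.repr.toEquiv.nontrivial
    Subgroup.eq_bot_of_isPGroup_of_irreducible hirr hN hp

theorem detKer_matrixRep {k V : Type} [Field k] [AddCommGroup V] [Module k V]
    (b : Module.Basis (Fin 2) k V) (H : Subgroup (V ≃ₗ[k] V)) :
    detKer (matrixRep b H) = slPart H := by
  ext g
  rw [mem_detKer, det_matrixRep, Units.val_eq_one]
  rfl

/-- Let `p` be an odd prime, `k` a finite field of characteristic `p`, `V` a
`2`-dimensional `k`-vector space and `H ≤ GL(V)` acting irreducibly on `V` and containing no
scalar automorphism `λ·id` with `λ ≠ 1`.  Then (1) `p ∤ #H`; (2) `A := H ∩ SL(V)` is cyclic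
of odd order `n > 2` with `n ∣ #k - 1` or `n ∣ #k + 1`; (3) `[H : A] ≤ 2`, and if `[H : A] = 2`
then every `s ∈ H ∖ A` satisfies `s² = 1` and `s a s⁻¹ = a⁻¹` for all `a ∈ A` (so `H` is
dihedral of order `2n`), and `det(H) = {1, -1} ⊆ k^×`. -/
theorem stmt8 {k V : Type} [Field k] [Fintype k] [AddCommGroup V] [Module k V]
    [FiniteDimensional k V]
    (p : ℕ) (hp : p.Prime) (hp2 : p ≠ 2) [CharP k p]
    (hdim : Module.finrank k V = 2)
    (H : Subgroup (V ≃ₗ[k] V))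
    (hirr : ∀ W : Submodule k V,
      (∀ g ∈ H, ∀ v ∈ W, g v ∈ W) → W = ⊥ ∨ W = ⊤)
    (hhom : ∀ g ∈ H, ∀ c : k, (∀ v : V, g v = c • v) → c = 1) :
    ¬ (p ∣ Nat.card H) ∧
    ∃ n : ℕ, Odd n ∧ 2 < n ∧
      (n ∣ Fintype.card k - 1 ∨ n ∣ Fintype.card k + 1) ∧
      IsCyclic (slPart H) ∧ Nat.card (slPart H) = n ∧
      (slPart H).index ≤ 2 ∧
      ((slPart H).index = 2 →
        (∀ s : H, s ∉ slPart H → s ^ 2 = 1 ∧ ∀ a ∈ slPart H, s * a * s⁻¹ = a⁻¹) ∧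
        (Set.range fun h : H => LinearEquiv.det (h : V ≃ₗ[k] V)) = {1, -1}) := by
  have := Fact.mk hp
  have : Finite V := Module.finite_of_finite k
  have : Finite (V ≃ₗ[k] V) := Finite.of_injective _ DFunLike.coe_injective
  have h2 : (2 : k) ≠ 0 := Ring.two_ne_zero (by rwa [ringChar.eq k p])
  let b := Module.finBasisOfFinrankEq k V hdim
  have h := isScalarFreeIrreducible_matrixRep (p := p) b hirr hhom
  have hmem (s : H) : s ∈ slPart H ↔ LinearEquiv.det (s : V ≃ₗ[k] V) = 1 := Iff.rfl
  rw [← detKer_matrixRep b H] at *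
  have hodd := h.odd_card_detKer h2
  refine ⟨fun hdvd => ?_, _, hodd, ?_, h.card_detKer_dvd h2, h.isCyclic_detKer h2, rfl,
    h.index_detKer_le_two h2, fun hidx => ⟨fun s hs => ⟨h.sq_eq_one_of_notMem h2 hs,
      fun a ha => h.conj_eq_inv_of_notMem h2 ha hs⟩, ?_⟩⟩
  · rw [← Subgroup.card_mul_index (detKer (matrixRep b H)), hp.dvd_mul] at hdvd
    rcases hdvd with hdvd | hdvd
    · exact h.not_dvd_card_detKer h2 hdvd
    · have hpos := Nat.pos_of_ne_zero (Subgroup.FiniteIndex.index_ne_zero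
        (H := detKer (matrixRep b H)))
      exact hp2 (le_antisymm ((Nat.le_of_dvd hpos hdvd).trans (h.index_detKer_le_two h2))
        hp.two_le)
  · obtain ⟨a, ha, ha1⟩ := h.exists_mem_detKer_ne_one
    have := (Subgroup.one_lt_card_iff_ne_bot (detKer (matrixRep b H))).2
      fun hbot => ha1 (by rwa [hbot, Subgroup.mem_bot] at ha)
    obtain ⟨m, hm⟩ := hodd
    omega
  · have hdet (s : H) (hs : s ∉ detKer (matrixRep b H)) :
        LinearEquiv.det (s : V ≃ₗ[k] V) = -1 := by
      have hsq := congrArg (fun t : H => LinearEquiv.det (t : V ≃ₗ[k] V))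
        (h.sq_eq_one_of_notMem h2 hs)
      simp only [sq, Subgroup.coe_mul, map_mul, Subgroup.coe_one, map_one] at hsq
      exact ((Units.inv_eq_self_iff _).1 (inv_eq_of_mul_eq_one_left hsq)).resolve_left
        fun h1 => hs ((hmem s).2 h1)
    have hne : ∃ s, s ∉ detKer (matrixRep b H) := by
      by_contra! hall
      rw [(Subgroup.eq_top_iff' _).2 hall, Subgroup.index_top] at hidx
      omega
    refine Set.Subset.antisymm ?_ ?_
    · rintro _ ⟨s, rfl⟩
      by_cases hs : s ∈ detKer (matrixRep b H)
      · exact Or.inl ((hmem s).1 hs)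
      · exact Or.inr (hdet s hs)
    · rintro _ (rfl | rfl)
      · exact ⟨1, map_one _⟩
      · exact hne.imp hdet
end

section
/- Let p be an odd prime, k a finite field of characteristic p, V a 2-dimensional k-vector space, and H a subgroup of GL(V) such that V is a semisimple k[H]-module. Then the group cohomology Hⁱ(H, V) vanishes for every i > 0. -/
/-- The tautological representation of a subgroup `H ≤ GL(V)` on `V`. -/
def inclRep {k V : Type} [Field k] [AddCommGroup V] [Module k V]
    (H : Subgroup (V ≃ₗ[k] V)) : Representation k H V :=
  LinearEquiv.automorphismGroup.toLinearMapMonoidHom.comp H.subtype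

/-- A central element of `G` acts on every representation of `G` by an endomorphism. -/
def Rep.centralHom {k G : Type} [Field k] [Group G] (z : G) (hz : z ∈ Submonoid.center G)
    (A : Rep k G) : A ⟶ A :=
  Rep.ofHom (Representation.IntertwiningMap.centralMul A.ρ z hz)

open CategoryTheory in
lemma Rep.centralHom_comm {k G : Type} [Field k] [Group G] (z : G) (hz : z ∈ Submonoid.center G)
    {A B : Rep k G} (f : A ⟶ B) :
    f ≫ Rep.centralHom z hz B = Rep.centralHom z hz A ≫ f := by
  ext v
  exact (Rep.hom_comm_apply f z v).symm

open CategoryTheory in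
/-- If a central element acts on `A` by a scalar `c` such that `c - 1` is invertible, then the
higher cohomology of `A` vanishes. -/
lemma groupCohomology.isZero_succ_of_central {k G : Type} [Field k] [Group G] (A : Rep k G)
    (z : G) (hz : z ∈ Submonoid.center G) (c : k) (hc : c ≠ 1)
    (hzc : ∀ v : A, A.ρ z v = c • v) (n : ℕ) :
    Limits.IsZero (groupCohomology A (n + 1)) := by
  let P := Rep.barResolution k G
  refine Limits.IsZero.of_iso ?_ (groupCohomologyIso A (n + 1) P)
  let φ : P.complex ⟶ P.complex :=
    { f := fun i => Rep.centralHom z hz (P.complex.X i)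
      comm' := fun i j _ => (Rep.centralHom_comm z hz _).symm }
  have hπ : φ ≫ P.π = P.π ≫ (ChainComplex.single₀ (Rep k G)).map (𝟙 _) := by
    rw [CategoryTheory.Functor.map_id, Category.comp_id]
    ext : 1
    change Rep.centralHom z hz _ ≫ P.π.f 0 = P.π.f 0
    let e := HomologicalComplex.singleObjXSelf (ComplexShape.down ℕ) 0 (Rep.trivial k G k)
    have htriv : Rep.centralHom z hz (Rep.trivial k G k) = 𝟙 _ := by
      ext
      rfl
    have he : Rep.centralHom z hz (((ChainComplex.single₀ (Rep k G)).obj (Rep.trivial k G k)).X 0) =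
        𝟙 _ := by
      rw [← cancel_mono e.hom, ← Rep.centralHom_comm, htriv, Category.comp_id, Category.id_comp]
    rw [← Rep.centralHom_comm]
    exact (congrArg (P.π.f 0 ≫ ·) he).trans (Category.comp_id _)
  let H := ProjectiveResolution.liftHomotopy (𝟙 _) φ (𝟙 _) hπ (by simp)
  have hH := H.comm (n + 1)
  rw [← HomologicalComplex.exactAt_iff_isZero_homology,
    HomologicalComplex.exactAt_iff' _ n (n + 1) (n + 2) (by simp) (by simp),
    ShortComplex.moduleCat_exact_iff]
  intro (f : P.complex.X (n + 1) ⟶ A) hf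
  have hf' : P.complex.d (n + 2) (n + 1) ≫ f = 0 := by
    simpa using! hf
  have key : (c - 1) • f = P.complex.d (n + 1) n ≫ H.hom n (n + 1) ≫ f := by
    have h1 : φ.f (n + 1) ≫ f = c • f := by
      change Rep.centralHom z hz _ ≫ f = _
      rw [← Rep.centralHom_comm]
      ext v
      exact hzc _
    rw [sub_smul, ← h1, hH]
    simp [dNext_eq H.hom (show (ComplexShape.down ℕ).Rel (n + 1) n from rfl),
      prevD_eq H.hom (show (ComplexShape.down ℕ).Rel (n + 2) (n + 1) from rfl), hf']
  refine ⟨((c - 1)⁻¹ • H.hom n (n + 1) ≫ f : P.complex.X n ⟶ A), ?_⟩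
  have : P.complex.d (n + 1) n ≫ ((c - 1)⁻¹ • H.hom n (n + 1) ≫ f) = f := by
    rw [Linear.comp_smul, ← key, smul_smul, inv_mul_cancel₀ (sub_ne_zero.2 hc), one_smul]
  simpa using! this

/-- Two elements of `p`-power order have, up to conjugation, a common nonzero fixed vector. -/
lemma exists_common_fixed_vector_up_to_conj {G V : Type*} [Group G] [Finite G] [AddCommGroup V]
    [Finite V] [DistribMulAction G V] {p : ℕ} [Fact p.Prime] (hV : p ∣ Nat.card V) {x y : G}
    (hx : x ^ p = 1) (hy : y ^ p = 1) :
    ∃ (g : G) (v : V), v ≠ 0 ∧ x • v = v ∧ y • g • v = g • v := by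
  have hpg : ∀ u : G, u ^ p = 1 → IsPGroup p (Subgroup.zpowers u) := by
    intro u hu
    rintro ⟨w, hw⟩
    obtain ⟨m, rfl⟩ := hw
    refine ⟨1, Subtype.ext ?_⟩
    simp only [pow_one, Subgroup.coe_pow, Subgroup.coe_one]
    rw [← zpow_natCast, zpow_comm, zpow_natCast, hu, one_zpow]
  obtain ⟨Q₁, hQ₁⟩ := (hpg x hx).exists_le_sylow
  obtain ⟨Q₂, hQ₂⟩ := (hpg y hy).exists_le_sylow
  obtain ⟨g, rfl⟩ := MulAction.exists_smul_eq G Q₁ Q₂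
  obtain ⟨v, hv, hv0⟩ := Q₁.isPGroup'.exists_fixed_point_of_prime_dvd_card_of_fixed_point V hV
    (a := 0) (fun q => smul_zero q)
  have hfix : ∀ q ∈ Q₁, q • v = v := fun q hq => hv ⟨q, hq⟩
  refine ⟨g, v, hv0.symm, hfix x (hQ₁ (Subgroup.mem_zpowers x)), ?_⟩
  have hyg := hQ₂ (Subgroup.mem_zpowers y)
  rw [Sylow.coe_subgroup_smul, Subgroup.mem_pointwise_smul_iff_inv_smul_mem] at hyg
  have h := hfix _ hyg
  rw [MulAut.smul_def, ← map_inv, MulAut.conj_apply, inv_inv, mul_smul, mul_smul,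
    inv_smul_eq_iff] at h
  exact h

/-- The powers of a unipotent endomorphism of the span of `e` and `f`. -/
lemma LinearEquiv.pow_apply_of_unipotent {k V : Type*} [Field k] [AddCommGroup V] [Module k V]
    (u : V ≃ₗ[k] V) {e f : V} {a : k} (he : u e = e) (hf : u f = f + a • e) (n : ℕ) :
    (u ^ n) e = e ∧ (u ^ n) f = f + ((n : k) * a) • e := by
  induction n with
  | zero => simp
  | succ n ih =>
    rw [pow_succ', LinearEquiv.mul_apply, LinearEquiv.mul_apply, ih.1, ih.2, map_add, map_smul,
      he, hf]
    refine ⟨rfl, ?_⟩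
    push_cast
    module

lemma LinearEquiv.pow_char_eq_one_of_unipotent {k V : Type*} [Field k] [AddCommGroup V] [Module k V]
    (p : ℕ) [CharP k p] (b : Module.Basis (Fin 2) k V) (u : V ≃ₗ[k] V) {i j : Fin 2} (hij : i ≠ j)
    {a : k} (hi : u (b i) = b i) (hj : u (b j) = b j + a • b i) : u ^ p = 1 := by
  have h := u.pow_apply_of_unipotent hi hj p
  rw [CharP.cast_eq_zero k p, zero_mul, zero_smul, add_zero] at h
  refine LinearEquiv.toLinearMap_injective (b.ext fun l => ?_)
  obtain rfl | rfl : l = i ∨ l = j := by omega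
  exacts [h.1, h.2]

/-- In odd characteristic `p`, two noncommuting transvections of a plane generate a group
containing `-1`. -/
lemma neg_mem_closure_of_transvections {k V : Type*} [Field k] [AddCommGroup V] [Module k V]
    [Finite V] (p : ℕ) [Fact p.Prime] (hp2 : p ≠ 2) [CharP k p] (b : Module.Basis (Fin 2) k V)
    (x y : V ≃ₗ[k] V) {a c : k} (ha : a ≠ 0) (hc : c ≠ 0)
    (hx0 : x (b 0) = b 0) (hx1 : x (b 1) = b 1 + a • b 0)
    (hy1 : y (b 1) = b 1) (hy0 : y (b 0) = b 0 + c • b 1) :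
    LinearEquiv.neg k ∈ Subgroup.closure {x, y} := by
  set G := Subgroup.closure {x, y} with hG
  have hxG : x ∈ G := Subgroup.subset_closure (by simp)
  have hyG : y ∈ G := Subgroup.subset_closure (by simp)
  have : Finite (V ≃ₗ[k] V) := DFunLike.finite _
  have hxp := x.pow_char_eq_one_of_unipotent p b (by decide) hx0 hx1
  have hyp := y.pow_char_eq_one_of_unipotent p b (by decide) hy1 hy0
  have hV : p ∣ Nat.card V := by
    have h : p • b 0 = 0 := by
      rw [← Nat.cast_smul_eq_nsmul k, CharP.cast_eq_zero, zero_smul]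
    rw [← addOrderOf_eq_prime h (b.ne_zero 0)]
    exact addOrderOf_dvd_natCard _
  obtain ⟨⟨g, hg⟩, v, hv, hxv, hyv⟩ := exists_common_fixed_vector_up_to_conj (G := G) (V := V) hV
    (x := ⟨x, hxG⟩) (y := ⟨y, hyG⟩) (Subtype.ext hxp) (Subtype.ext hyp)
  replace hxv : x v = v := hxv
  replace hyv : y (g v) = g v := hyv
  have hfix : ∀ (u : V ≃ₗ[k] V) (i j : Fin 2) (r : k) (w : V), i ≠ j → r ≠ 0 → u (b i) = b i →
      u (b j) = b j + r • b i → u w = w → w = b.repr w i • b i := by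
    intro u i j r w hij hr hi hj hw
    have hsum : w = b.repr w i • b i + b.repr w j • b j := by
      conv_lhs => rw [← b.sum_repr w]
      rw [Fin.sum_univ_two]
      obtain ⟨rfl, rfl⟩ | ⟨rfl, rfl⟩ : (i = 0 ∧ j = 1) ∨ (i = 1 ∧ j = 0) := by omega
      exacts [rfl, add_comm _ _]
    have h : (b.repr w j * r) • b i = 0 := by
      have h' := hw
      rw [hsum, map_add, map_smul, map_smul, hi, hj] at h'
      rw [mul_smul]
      simpa using h'
    have h0 : b.repr w j = 0 := by
      simpa [hr, b.ne_zero i] using h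
    rwa [h0, zero_smul, add_zero] at hsum
  obtain ⟨s, hs⟩ : ∃ s : k, g (b 0) = s • b 1 := by
    have h1 := hfix x 0 1 a v (by decide) ha hx0 hx1 hxv
    have h2 := hfix y 1 0 c (g v) (by decide) hc hy1 hy0 hyv
    have h3 : b.repr v 0 ≠ 0 := fun h => hv (by rw [h1, h, zero_smul])
    refine ⟨(b.repr v 0)⁻¹ * b.repr (g v) 1, ?_⟩
    rw [mul_smul, ← h2, ← map_smul, inv_smul_eq_iff₀ h3 |>.2 h1]
  have hs0 : s ≠ 0 := by
    rintro rfl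
    rw [zero_smul, map_eq_zero_iff g g.injective] at hs
    exact b.ne_zero 0 hs
  let δ₀ : V →ₗ[k] V := b.constr k ![-b 0, b 1]
  have hδ₀0 : δ₀ (b 0) = -b 0 := by simp [δ₀, b.constr_basis]
  have hδ₀1 : δ₀ (b 1) = b 1 := by simp [δ₀, b.constr_basis]
  have hδ₀ : Function.Involutive δ₀ := by
    intro w
    have : δ₀ ∘ₗ δ₀ = LinearMap.id := by
      refine b.ext fun i => ?_
      fin_cases i <;> simp [hδ₀0, hδ₀1]
    exact LinearMap.congr_fun this w
  let δ : V ≃ₗ[k] V := LinearEquiv.ofInvolutive δ₀ hδ₀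
  have hδ0 : δ (b 0) = -b 0 := hδ₀0
  have hδ1 : δ (b 1) = b 1 := hδ₀1
  have hδi : δ⁻¹ = δ := by
    rw [inv_eq_iff_mul_eq_one]
    exact LinearEquiv.ext hδ₀
  have hδx : δ * x * δ⁻¹ = x⁻¹ := by
    rw [hδi, eq_inv_iff_mul_eq_one]
    refine LinearEquiv.toLinearMap_injective (b.ext fun i => ?_)
    fin_cases i <;> simp [hδ0, hδ1, hx0, hx1]
  have hδy : δ * y * δ⁻¹ = y⁻¹ := by
    rw [hδi, eq_inv_iff_mul_eq_one]
    refine LinearEquiv.toLinearMap_injective (b.ext fun i => ?_)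
    fin_cases i <;> simp [hδ0, hδ1, hy0, hy1]
  have hδG : ∀ u ∈ G, δ * u * δ⁻¹ ∈ G := by
    have : G ≤ G.comap (MulAut.conj δ).toMonoidHom := by
      rw [hG, Subgroup.closure_le]
      rintro u (rfl | rfl)
      · change δ * u * δ⁻¹ ∈ G
        rw [hδx]
        exact inv_mem hxG
      · change δ * u * δ⁻¹ ∈ G
        rw [hδy]
        exact inv_mem hyG
    exact this
  let z : V ≃ₗ[k] V := g * (δ * g⁻¹ * δ⁻¹)
  have hz : z ∈ G := mul_mem hg (hδG _ (inv_mem hg))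
  have hz1 : z (b 1) = -b 1 := by
    have h : g⁻¹ (b 1) = s⁻¹ • b 0 := by
      rw [eq_inv_smul_iff₀ hs0, ← map_smul, ← hs]
      exact g.symm_apply_apply _
    simp only [z, hδi, LinearEquiv.mul_apply, hδ1, h, map_smul, hδ0, map_neg, hs]
    rw [smul_neg, inv_smul_smul₀ hs0]
  have hdet : LinearMap.det (z : V →ₗ[k] V) = 1 := by
    have : LinearEquiv.det z = 1 := by
      simp only [z, map_mul, map_inv]
      rw [mul_assoc, mul_comm (LinearEquiv.det g)⁻¹, mul_inv_cancel_left, mul_inv_cancel]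
    rw [← LinearEquiv.coe_det, this, Units.val_one]
  have hz0 : z (b 0) = -b 0 + b.repr (z (b 0)) 1 • b 1 := by
    have h0 : b.repr (z (b 0)) 0 = -1 := by
      rw [← LinearMap.det_toMatrix b, Matrix.det_fin_two] at hdet
      simp [LinearMap.toMatrix_apply, hz1] at hdet
      linear_combination -hdet
    conv_lhs => rw [← b.sum_repr (z (b 0)), Fin.sum_univ_two, h0, neg_one_smul]
  set d := b.repr (z (b 0)) 1
  have hodd : Odd p := (Fact.out : p.Prime).odd_of_ne_two hp2
  have hneg2 : (LinearEquiv.neg k : V ≃ₗ[k] V) ^ 2 = 1 := by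
    ext w
    simp [pow_two]
  have hnegp : (LinearEquiv.neg k : V ≃ₗ[k] V) ^ p = LinearEquiv.neg k := by
    obtain ⟨m, rfl⟩ := hodd
    rw [pow_succ, pow_mul, hneg2, one_pow, one_mul]
  have hcomm : Commute (LinearEquiv.neg k) z := by
    ext w
    simp
  have hu : (LinearEquiv.neg k * z) ^ p = 1 := by
    refine LinearEquiv.pow_char_eq_one_of_unipotent p b _ (i := 1) (j := 0) (a := -d)
      (by decide) ?_ ?_
    · simp [hz1]
    · rw [LinearEquiv.mul_apply, hz0]
      simp [add_comm]
  rw [hcomm.mul_pow, hnegp, mul_eq_one_iff_inv_eq] at hu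
  have : (LinearEquiv.neg k : V ≃ₗ[k] V)⁻¹ = LinearEquiv.neg k := by
    rw [inv_eq_iff_mul_eq_one, ← pow_two, hneg2]
  rw [← this, hu]
  exact pow_mem hz p

/-- If a subgroup `H` of `GL(V)`, `V` a plane over a field of odd characteristic `p`, has order
divisible by `p` and `V` is a semisimple `H`-module, then `-1 ∈ H`. -/
lemma neg_mem_of_semisimple_of_dvd_card {k V : Type*} [Field k] [AddCommGroup V]
    [Module k V] [Finite V] (p : ℕ) [Fact p.Prime] (hp2 : p ≠ 2) [CharP k p]
    (hdim : Module.finrank k V = 2) (H : Subgroup (V ≃ₗ[k] V))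
    (hss : ∀ W : Submodule k V, (∀ h : H, ∀ v ∈ W, (h : V ≃ₗ[k] V) v ∈ W) →
      ∃ W' : Submodule k V, (∀ h : H, ∀ v ∈ W', (h : V ≃ₗ[k] V) v ∈ W') ∧ IsCompl W W')
    (hcard : p ∣ Nat.card H) : LinearEquiv.neg k ∈ H := by
  have : Finite (V ≃ₗ[k] V) := DFunLike.finite _
  have : FiniteDimensional k V := Module.finite_of_finrank_eq_succ hdim
  obtain ⟨⟨x, hxH⟩, hx⟩ := exists_prime_orderOf_dvd_card' p hcard
  rw [Subgroup.orderOf_mk] at hx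
  let N : Module.End k V := x - 1
  have hN : ∀ v, N v = x v - v := fun v => rfl
  have hN0 : N ≠ 0 := by
    intro h
    have : x = 1 := by
      ext v
      exact sub_eq_zero.1 (LinearMap.congr_fun h v)
    rw [this, orderOf_one] at hx
    exact (Fact.out : p.Prime).one_lt.ne hx
  have hNsq : ∀ v, N (N v) = 0 := by
    have : Nontrivial V := Module.nontrivial_of_finrank_pos (R := k) (by omega)
    have : CharP (Module.End k V) p := charP_of_injective_algebraMap' k p
    have hNp : N ^ p = 0 := by
      have hxp : (x : Module.End k V) ^ p = 1 := by
        have h := congrArg (LinearEquiv.automorphismGroup.toLinearMapMonoidHom (R := k) (M := V))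
          (hx ▸ pow_orderOf_eq_one x)
        rwa [map_pow, map_one] at h
      rw [sub_pow_char_of_commute p (Commute.one_right _), hxp, one_pow, sub_self]
    have h2 : N ^ 2 = 0 := by
      have h := LinearMap.aeval_self_charpoly N
      rwa [IsNilpotent.charpoly_eq_X_pow_finrank ⟨p, hNp⟩, hdim, Polynomial.aeval_X_pow] at h
    intro v
    rw [pow_two] at h2
    exact LinearMap.congr_fun h2 v
  obtain ⟨f, hf⟩ : ∃ f, N f ≠ 0 := by
    by_contra! h
    exact hN0 (LinearMap.ext h)
  set e := N f with he
  have hker : ∀ v, N v = 0 ↔ ∃ r : k, r • e = v := by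
    have hle : k ∙ e ≤ LinearMap.ker N := by
      rw [Submodule.span_singleton_le_iff_mem]
      exact hNsq f
    have hfin : Module.finrank k (LinearMap.ker N) ≤ Module.finrank k (k ∙ e) := by
      rw [finrank_span_singleton hf]
      have hr := LinearMap.finrank_range_add_finrank_ker N
      have : Module.finrank k (LinearMap.range N) ≠ 0 := by
        rw [Ne, Submodule.finrank_eq_zero, LinearMap.range_eq_bot]
        exact hN0
      omega
    intro v
    rw [← LinearMap.mem_ker, ← Submodule.eq_of_le_of_finrank_le hle hfin,
      Submodule.mem_span_singleton]
  obtain ⟨h, hh, hhe⟩ : ∃ h ∈ H, N (h e) ≠ 0 := by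
    by_contra! hstab
    obtain ⟨W', hW', hcompl⟩ := hss (LinearMap.ker N) (by
      rintro ⟨h, hh⟩ v hv
      obtain ⟨r, rfl⟩ := (hker v).1 hv
      rw [LinearMap.mem_ker, map_smul, map_smul, hstab h hh, smul_zero])
    have hle : W' ≤ LinearMap.ker N := fun w hw =>
      (Submodule.disjoint_def.1 hcompl.disjoint _ (hNsq w) (sub_mem (hW' ⟨x, hxH⟩ w hw) hw))
    rw [hcompl.disjoint.symm.eq_bot_of_le hle] at hcompl
    exact hN0 (LinearMap.ker_eq_top.1 (eq_top_of_isCompl_bot hcompl))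
  have hxe : x e = e := sub_eq_zero.1 (hNsq f)
  obtain ⟨a, ha⟩ := (hker _).1 (hNsq (h e))
  have ha0 : a ≠ 0 := by
    rintro rfl
    exact hhe (by rw [← ha, zero_smul])
  let y := h * x * h⁻¹
  have hyv : ∀ v, y v = v + h (N (h⁻¹ v)) := by
    intro v
    change h (x (h⁻¹ v)) = _
    rw [hN, map_sub]
    change _ = v + (_ - h (h.symm v))
    rw [LinearEquiv.apply_symm_apply, add_sub_cancel]
  obtain ⟨c, hc⟩ := (hker _).1 (hNsq (h⁻¹ e))
  have hye : y e = e + c • h e := by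
    rw [hyv, ← hc, map_smul]
  have hyhe : y (h e) = h e := by
    rw [hyv]
    change _ + h (N (h.symm (h e))) = _
    rw [LinearEquiv.symm_apply_apply, hNsq, map_zero, add_zero]
  have hli : LinearIndependent k ![e, h e] := by
    rw [LinearIndependent.pair_iff' hf]
    intro r hr
    exact hhe ((hker _).2 ⟨r, hr⟩)
  have hc0 : c ≠ 0 := by
    rintro rfl
    rw [zero_smul, eq_comm, hker] at hc
    obtain ⟨r, hr⟩ := hc
    rw [LinearEquiv.coe_inv, LinearEquiv.eq_symm_apply, map_smul] at hr
    have := LinearIndependent.pair_iff.1 hli 1 (-r) (by rw [neg_smul, hr]; module)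
    exact one_ne_zero this.1
  let b := basisOfLinearIndependentOfCardEqFinrank hli (by simp [hdim])
  have hb0 : b 0 = e := by simp [b]
  have hb1 : b 1 = h e := by simp [b]
  refine (Subgroup.closure_le H).2 ?_ (neg_mem_closure_of_transvections p hp2 b x y ha0 hc0
    ?_ ?_ ?_ ?_)
  · rintro u (rfl | rfl)
    exacts [hxH, mul_mem (mul_mem hh hxH) (inv_mem hh)]
  · rw [hb0, hxe]
  · rw [hb0, hb1, ha, hN, add_sub_cancel]
  · rw [hb1, hyhe]
  · rw [hb0, hb1, hye]

/-- Let `p` be an odd prime, `k` a finite field of characteristic `p`, `V`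
a `2`-dimensional `k`-vector space and `H ≤ GL(V)` such that `V` is a semisimple
`k[H]`-module (formalized, following Mathlib's definition of semisimplicity, as: every
`H`-stable subspace of `V` admits an `H`-stable complement).  Then `Hⁱ(H, V) = 0` for all
`i > 0`. -/
theorem stmt10 {k V : Type} [Field k] [Fintype k] [AddCommGroup V] [Module k V]
    [FiniteDimensional k V]
    (p : ℕ) (hp : p.Prime) (hp2 : p ≠ 2) [CharP k p]
    (hdim : Module.finrank k V = 2)
    (H : Subgroup (V ≃ₗ[k] V))
    (hss : ∀ W : Submodule k V, (∀ h : H, ∀ v ∈ W, (h : V ≃ₗ[k] V) v ∈ W) →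
      ∃ W' : Submodule k V, (∀ h : H, ∀ v ∈ W', (h : V ≃ₗ[k] V) v ∈ W') ∧ IsCompl W W') :
    ∀ i : ℕ, 0 < i → Subsingleton (groupCohomology (Rep.of (inclRep H)) i) := by
  have : Fact p.Prime := ⟨hp⟩
  have : Finite V := Module.finite_of_finite k
  have : Finite (V ≃ₗ[k] V) := DFunLike.finite _
  intro i hi
  obtain ⟨n, rfl⟩ := Nat.exists_eq_succ_of_ne_zero hi.ne'
  apply ModuleCat.subsingleton_of_isZero
  by_cases hcard : p ∣ Nat.card H
  · have hneg := neg_mem_of_semisimple_of_dvd_card p hp2 hdim H hss hcard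
    refine groupCohomology.isZero_succ_of_central _ ⟨LinearEquiv.neg k, hneg⟩ ?_ (-1) ?_ ?_ n
    · rw [Submonoid.mem_center_iff]
      rintro ⟨h, hh⟩
      ext v
      simp
    · exact Ring.neg_one_ne_one_of_char_ne_two (by rwa [ringChar.eq k p])
    · intro v
      exact (neg_one_smul k v).symm
  · have : NeZero (Nat.card H : k) := ⟨by rwa [Ne, CharP.cast_eq_zero_iff k p]⟩
    exact (isZero_Ext_succ_of_projective (Rep.trivial k H k) _ n).of_iso
      (groupCohomologyIsoExt _ _)
end
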